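/- Let q be a prime power and let n, k₁, k₂, t be positive integers with k₁ ≥ t + 1, k₂ ≥ t + 1 and n ≥ k₁ + k₂ + t + 7. Suppose F₁ ⊆ M(k₁,n) and F₂ ⊆ M(k₂,n) are maximal non-trivial cross t-intersecting families (maximal meaning F₁ = {F ∈ M(k₁,n) : dim(F ∩ G) ≥ t for all G ∈ F₂} and F₂ = {G ∈ M(k₂,n) : dim(F ∩ G) ≥ t for all F ∈ F₁}) with τ_t(F₁) = t and τ_t(F₂) = t + 1. Then one of the following holds: (1) there exist M ∈ M(k₂+1,n) and a t-flat T ⊆ M with F₁ = A₁(M,T;k₁,t) and F₂ = A₂(M,T;k₂,t); (2) there exists S ∈ M(t+1,n) with F₁ = A₃(S;k₁) and F₂ = A₄(S;k₂,t); (3) for every M ∈ M(k₂+1,n) and every t-flat T ⊆ M, |F₁|·|F₂| < |A₁(M,T;k₁,t)|·|A₂(M,T;k₂,t)|. -/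

import Mathlib

open Module Set

/-- Gaussian binomial coefficient `[n k]_q`, as a rational number, via the
product formula `∏_{0 ≤ i < k} (q^{n-i} - 1)/(q^{k-i} - 1)`. -/
noncomputable def gaussQ (q n k : ℕ) : ℚ :=
  ∏ i ∈ Finset.range k, ((q : ℚ) ^ (n - i) - 1) / ((q : ℚ) ^ (k - i) - 1)

/-- `A` is a `k`-flat of the affine space `AG(n, q)` (with `q = |𝔽|`):
a coset `x + P` of a `k`-dimensional linear subspace `P` of `𝔽^n`. -/
def IsFlat (𝔽 : Type) [Field 𝔽] {n : ℕ} (k : ℕ) (A : Set (Fin n → 𝔽)) : Prop :=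
  ∃ (P : Submodule 𝔽 (Fin n → 𝔽)) (x : Fin n → 𝔽),
    Module.finrank 𝔽 ↥P = k ∧ A = {v | v - x ∈ P}

/-- `A` is a flat (in particular nonempty) of dimension at least `t`. -/
def DimGe (𝔽 : Type) [Field 𝔽] {n : ℕ} (t : ℕ) (A : Set (Fin n → 𝔽)) : Prop :=
  ∃ j, t ≤ j ∧ IsFlat 𝔽 j A

/-- Two families of flats are cross `t`-intersecting. -/
def CrossT (𝔽 : Type) [Field 𝔽] {n : ℕ} (t : ℕ)
    (F1 F2 : Set (Set (Fin n → 𝔽))) : Prop :=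
  ∀ A ∈ F1, ∀ B ∈ F2, DimGe 𝔽 t (A ∩ B)

/-- A pair of families is trivial: some `t`-flat is contained in every member. -/
def TrivialPair (𝔽 : Type) [Field 𝔽] {n : ℕ} (t : ℕ)
    (F1 F2 : Set (Set (Fin n → 𝔽))) : Prop :=
  ∃ T : Set (Fin n → 𝔽), IsFlat 𝔽 t T ∧ (∀ A ∈ F1, T ⊆ A) ∧ (∀ B ∈ F2, T ⊆ B)

/-- `T` is a `t`-cover of the family `F`: `dim (T ∩ A) ≥ t` for all `A ∈ F`. -/
def IsTCover (𝔽 : Type) [Field 𝔽] {n : ℕ} (t : ℕ) (T : Set (Fin n → 𝔽))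
    (F : Set (Set (Fin n → 𝔽))) : Prop :=
  ∀ A ∈ F, DimGe 𝔽 t (T ∩ A)

/-- `τ_t(F)`: the minimum dimension of a `t`-cover of `F`. -/
noncomputable def tauT (𝔽 : Type) [Field 𝔽] {n : ℕ} (t : ℕ)
    (F : Set (Set (Fin n → 𝔽))) : ℕ :=
  sInf {x | ∃ T : Set (Fin n → 𝔽), IsFlat 𝔽 x T ∧ IsTCover 𝔽 t T F}

/-- `A₁(M, T; k, t) = {F ∈ M(k,n) : T ⊆ F, dim(F ∩ M) ≥ t + 1}`. -/
def A1 (𝔽 : Type) [Field 𝔽] {n : ℕ} (M T : Set (Fin n → 𝔽)) (k t : ℕ) :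
    Set (Set (Fin n → 𝔽)) :=
  {F | IsFlat 𝔽 k F ∧ T ⊆ F ∧ DimGe 𝔽 (t + 1) (F ∩ M)}

/-- `A₂(M, T; k, t) = {F ∈ M(k,n) : T ⊆ F} ∪ {F ∈ M(k,n) : F ⊆ M, dim(F ∩ T) = t - 1}`. -/
def A2 (𝔽 : Type) [Field 𝔽] {n : ℕ} (M T : Set (Fin n → 𝔽)) (k t : ℕ) :
    Set (Set (Fin n → 𝔽)) :=
  {F | IsFlat 𝔽 k F ∧ T ⊆ F} ∪ {F | IsFlat 𝔽 k F ∧ F ⊆ M ∧ IsFlat 𝔽 (t - 1) (F ∩ T)}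

/-- `A₃(S; k) = {F ∈ M(k,n) : S ⊆ F}`. -/
def A3 (𝔽 : Type) [Field 𝔽] {n : ℕ} (S : Set (Fin n → 𝔽)) (k : ℕ) :
    Set (Set (Fin n → 𝔽)) :=
  {F | IsFlat 𝔽 k F ∧ S ⊆ F}

/-- `A₄(S; k, t) = {F ∈ M(k,n) : dim(F ∩ S) ≥ t}`. -/
def A4 (𝔽 : Type) [Field 𝔽] {n : ℕ} (S : Set (Fin n → 𝔽)) (k t : ℕ) :
    Set (Set (Fin n → 𝔽)) :=
  {F | IsFlat 𝔽 k F ∧ DimGe 𝔽 t (F ∩ S)}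

section Flats

variable {𝔽 : Type} [Field 𝔽] {n : ℕ} {i j k m s : ℕ} {A B C M P R : Set (Fin n → 𝔽)}
  {x y : Fin n → 𝔽}

theorem isFlat_coset (U : Submodule 𝔽 (Fin n → 𝔽)) (x : Fin n → 𝔽) :
    IsFlat 𝔽 (finrank 𝔽 U) {v | v - x ∈ U} :=
  ⟨U, x, rfl, rfl⟩

theorem IsFlat.nonempty (h : IsFlat 𝔽 k A) : A.Nonempty := by
  obtain ⟨U, x, -, rfl⟩ := h
  exact ⟨x, by simp⟩

/-- A flat is a coset based at any of its points. -/
theorem IsFlat.exists_eq_coset (h : IsFlat 𝔽 k A) (hx : x ∈ A) :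
    ∃ U : Submodule 𝔽 (Fin n → 𝔽), finrank 𝔽 U = k ∧ A = {v | v - x ∈ U} := by
  obtain ⟨U, y, hU, rfl⟩ := h
  refine ⟨U, hU, Set.ext fun v => ?_⟩
  have hx' : x - y ∈ U := hx
  have hv : v - y = v - x + (x - y) := by abel
  simp only [Set.mem_ofPred_eq, hv, U.add_mem_iff_left hx']

theorem coset_subset_coset_iff {U W : Submodule 𝔽 (Fin n → 𝔽)} :
    {v | v - x ∈ U} ⊆ {v | v - x ∈ W} ↔ U ≤ W := by
  refine ⟨fun h u hu => ?_, fun h v hv => h hv⟩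
  have : u + x ∈ {v | v - x ∈ W} := h (by simpa using hu)
  simpa using this

theorem IsFlat.inter (hA : IsFlat 𝔽 j A) (hB : IsFlat 𝔽 k B) (h : (A ∩ B).Nonempty) :
    ∃ i, IsFlat 𝔽 i (A ∩ B) := by
  obtain ⟨x, hxA, hxB⟩ := h
  obtain ⟨U, -, rfl⟩ := hA.exists_eq_coset hxA
  obtain ⟨W, -, rfl⟩ := hB.exists_eq_coset hxB
  exact ⟨_, U ⊓ W, x, rfl, by ext v; simp⟩

/-- The flat spanned by a flat and a point off it. -/
theorem IsFlat.exists_join_point (hP : IsFlat 𝔽 j P) (hx : x ∉ P) :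
    ∃ R, IsFlat 𝔽 (j + 1) R ∧ P ⊆ R ∧ x ∈ R ∧
      ∀ k K, IsFlat 𝔽 k K → P ⊆ K → x ∈ K → R ⊆ K := by
  obtain ⟨p, hp⟩ := hP.nonempty
  obtain ⟨U, rfl, rfl⟩ := hP.exists_eq_coset hp
  have hxU : x - p ∉ U := hx
  refine ⟨{v | v - p ∈ U ⊔ Submodule.span 𝔽 {x - p}}, ?_, ?_, ?_, fun k K hK hPK hxK => ?_⟩
  · rw [← Submodule.finrank_sup_span_singleton hxU]
    exact isFlat_coset _ _
  · exact coset_subset_coset_iff.2 le_sup_left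
  · exact le_sup_right (a := U) (Submodule.mem_span_singleton_self (x - p))
  · obtain ⟨W, -, rfl⟩ := hK.exists_eq_coset (hPK hp)
    refine coset_subset_coset_iff.2 (sup_le (coset_subset_coset_iff.1 hPK) ?_)
    simpa using hxK

/-- The flat spanned by two flats with a nonempty intersection. -/
theorem IsFlat.exists_join (hA : IsFlat 𝔽 j A) (hB : IsFlat 𝔽 k B) (hAB : IsFlat 𝔽 i (A ∩ B)) :
    ∃ M, IsFlat 𝔽 (j + k - i) M ∧ A ⊆ M ∧ B ⊆ M ∧
      ∀ m C, IsFlat 𝔽 m C → A ⊆ C → B ⊆ C → M ⊆ C := by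
  obtain ⟨p, hp⟩ := hAB.nonempty
  obtain ⟨W, hW, hABW⟩ := hAB.exists_eq_coset hp
  obtain ⟨U₁, rfl, rfl⟩ := hA.exists_eq_coset hp.1
  obtain ⟨U₂, rfl, rfl⟩ := hB.exists_eq_coset hp.2
  obtain rfl : U₁ ⊓ U₂ = W := by
    have h : {v | v - p ∈ U₁ ⊓ U₂} = {v | v - p ∈ W} := by
      rw [← hABW]
      ext v
      simp
    exact le_antisymm (coset_subset_coset_iff.1 h.subset) (coset_subset_coset_iff.1 h.superset)
  refine ⟨{v | v - p ∈ U₁ ⊔ U₂}, ?_, coset_subset_coset_iff.2 le_sup_left,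
    coset_subset_coset_iff.2 le_sup_right, fun m C hC hAC hBC => ?_⟩
  · rw [← hW, ← Submodule.finrank_sup_add_finrank_inf_eq, Nat.add_sub_cancel]
    exact isFlat_coset _ _
  · obtain ⟨W, -, rfl⟩ := hC.exists_eq_coset (hAC hp.1)
    exact coset_subset_coset_iff.2
      (sup_le (coset_subset_coset_iff.1 hAC) (coset_subset_coset_iff.1 hBC))

/-- The dimension formula inside a common flat. -/
theorem dimGe_inter_of_subset (hA : IsFlat 𝔽 j A) (hB : IsFlat 𝔽 k B) (hM : IsFlat 𝔽 m M)
    (hAM : A ⊆ M) (hBM : B ⊆ M) (h : (A ∩ B).Nonempty) (hs : m + s ≤ j + k) :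
    DimGe 𝔽 s (A ∩ B) := by
  obtain ⟨p, hpA, hpB⟩ := h
  obtain ⟨W, rfl, rfl⟩ := hM.exists_eq_coset (hAM hpA)
  obtain ⟨U₁, rfl, rfl⟩ := hA.exists_eq_coset hpA
  obtain ⟨U₂, rfl, rfl⟩ := hB.exists_eq_coset hpB
  refine ⟨finrank 𝔽 ↥(U₁ ⊓ U₂), ?_, U₁ ⊓ U₂, p, rfl, by ext v; simp⟩
  have h₁ := Submodule.finrank_sup_add_finrank_inf_eq U₁ U₂
  have h₂ := Submodule.finrank_mono
    (sup_le (coset_subset_coset_iff.1 hAM) (coset_subset_coset_iff.1 hBM))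
  omega

theorem isFlat_univ : IsFlat 𝔽 n (Set.univ : Set (Fin n → 𝔽)) :=
  ⟨⊤, 0, by simp, by simp⟩

/-- The `k`-flats through a `j`-flat and a further point are those through their join. -/
theorem IsFlat.exists_join_A3 (hP : IsFlat 𝔽 j P) (hx : x ∉ P) :
    ∃ R, IsFlat 𝔽 (j + 1) R ∧ ∀ k, {K ∈ A3 𝔽 P k | x ∈ K} = A3 𝔽 R k := by
  obtain ⟨R, hR, hPR, hxR, hmin⟩ := hP.exists_join_point hx
  refine ⟨R, hR, fun k => Set.ext fun K => ⟨fun h => ⟨h.1.1, hmin k K h.1.1 h.1.2 h.2⟩,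
    fun h => ⟨⟨h.1, hPR.trans h.2⟩, h.2 hxR⟩⟩⟩

variable [Fintype 𝔽]

theorem IsFlat.ncard_eq (h : IsFlat 𝔽 k A) : A.ncard = Fintype.card 𝔽 ^ k := by
  obtain ⟨U, x, rfl, rfl⟩ := h
  have : {v | v - x ∈ U} = (fun v => v + x) '' (U : Set (Fin n → 𝔽)) := by
    ext v
    simp [sub_eq_add_neg]
  rw [this, Set.ncard_image_of_injective _ (add_left_injective x), ← Nat.card_eq_fintype_card]
  exact natCard_eq_pow_finrank

theorem IsFlat.dim_le_of_subset (hA : IsFlat 𝔽 j A) (hB : IsFlat 𝔽 k B) (h : A ⊆ B) : j ≤ k := by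
  have := Set.ncard_le_ncard h B.toFinite
  rw [hA.ncard_eq, hB.ncard_eq] at this
  exact (Nat.pow_le_pow_iff_right Fintype.one_lt_card).1 this

theorem IsFlat.eq_of_subset (hA : IsFlat 𝔽 j A) (hB : IsFlat 𝔽 k B) (h : A ⊆ B) (hkj : k ≤ j) :
    A = B := by
  refine Set.eq_of_subset_of_ncard_le h ?_ B.toFinite
  rw [hA.ncard_eq, hB.ncard_eq]
  exact Nat.pow_le_pow_right Fintype.card_pos hkj

theorem IsFlat.dim_lt_of_subset_of_not_subset (hA : IsFlat 𝔽 j A) (hB : IsFlat 𝔽 k B)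
    (h : A ⊆ B) (h' : ¬ B ⊆ A) : j < k := by
  by_contra! hkj
  exact h' (hA.eq_of_subset hB h hkj).superset

theorem IsFlat.exists_superset (hP : IsFlat 𝔽 j P) (hj : j < n) :
    ∃ R, IsFlat 𝔽 (j + 1) R ∧ P ⊆ R := by
  obtain ⟨x, hx⟩ : ∃ x, x ∉ P := by
    by_contra! h
    exact hj.not_ge (isFlat_univ.dim_le_of_subset hP fun x _ => h x)
  obtain ⟨R, hR, hPR, -⟩ := hP.exists_join_point hx
  exact ⟨R, hR, hPR⟩

theorem DimGe.ncard_le (h : DimGe 𝔽 k A) : Fintype.card 𝔽 ^ k ≤ A.ncard := by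
  obtain ⟨j, hkj, hA⟩ := h
  rw [hA.ncard_eq]
  exact Nat.pow_le_pow_right Fintype.card_pos hkj

/-- If `A ∩ B` has dimension at least `dim A`, then `A ⊆ B`. -/
theorem IsFlat.subset_of_dimGe_inter (hA : IsFlat 𝔽 k A) (h : DimGe 𝔽 k (A ∩ B)) : A ⊆ B := by
  obtain ⟨j, hkj, hAB⟩ := h
  exact (hAB.eq_of_subset hA inter_subset_left hkj).superset.trans inter_subset_right

theorem dimGe_of_subset (hP : IsFlat 𝔽 k P) (hPA : P ⊆ A) (hA : IsFlat 𝔽 j A) : DimGe 𝔽 k A :=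
  ⟨j, hP.dim_le_of_subset hA hPA, hA⟩

theorem dimGe_inter_of_subset_subset (hP : IsFlat 𝔽 k P) (hA : IsFlat 𝔽 i A) (hB : IsFlat 𝔽 j B)
    (hPA : P ⊆ A) (hPB : P ⊆ B) : DimGe 𝔽 k (A ∩ B) := by
  obtain ⟨m, hm⟩ := hA.inter hB (hP.nonempty.mono (subset_inter hPA hPB))
  exact dimGe_of_subset hP (subset_inter hPA hPB) hm

theorem IsFlat.exists_join_point_of_mem (hP : IsFlat 𝔽 j P) (hx : x ∉ P) (hA : IsFlat 𝔽 k A)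
    (hPA : P ⊆ A) (hxA : x ∈ A) : DimGe 𝔽 (j + 1) A := by
  obtain ⟨R, hR, -, -, hmin⟩ := hP.exists_join_point hx
  exact dimGe_of_subset hR (hmin k A hA hPA hxA) hA

end Flats

section Counting

theorem ncard_mul_le_ncard_mul {α β : Type*} [Finite α] [Finite β] (r : α → β → Prop)
    {s : Set α} {t : Set β} {m d : ℕ} (hm : ∀ a ∈ s, m ≤ {b ∈ t | r a b}.ncard)
    (hd : ∀ b ∈ t, {a ∈ s | r a b}.ncard ≤ d) : s.ncard * m ≤ t.ncard * d := by
  classical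
  have := Fintype.ofFinite α
  have := Fintype.ofFinite β
  rw [Set.ncard_eq_toFinset_card', Set.ncard_eq_toFinset_card']
  refine Finset.card_mul_le_card_mul r (fun a ha => ?_) (fun b hb => ?_)
  · rw [← Set.ncard_coe_finset, Finset.coe_bipartiteAbove]
    simpa using hm a (by simpa using ha)
  · rw [← Set.ncard_coe_finset, Finset.coe_bipartiteBelow]
    simpa using hd b (by simpa using hb)

variable {𝔽 : Type} [Field 𝔽] [Fintype 𝔽] {n : ℕ} {j k : ℕ} {P R S : Set (Fin n → 𝔽)}

theorem IsFlat.ncard_diff (hP : IsFlat 𝔽 j P) (hR : IsFlat 𝔽 k R) (h : P ⊆ R) :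
    (R \ P).ncard = Fintype.card 𝔽 ^ k - Fintype.card 𝔽 ^ j := by
  rw [Set.ncard_sdiff h, hP.ncard_eq, hR.ncard_eq]

theorem ncard_A3_mul {c : ℕ} (hP : IsFlat 𝔽 j P)
    (hc : ∀ R : Set (Fin n → 𝔽), IsFlat 𝔽 (j + 1) R → (A3 𝔽 R k).ncard = c) :
    (A3 𝔽 P k).ncard * (Fintype.card 𝔽 ^ k - Fintype.card 𝔽 ^ j) =
      (Fintype.card 𝔽 ^ n - Fintype.card 𝔽 ^ j) * c := by
  have hout : (Pᶜ).ncard = Fintype.card 𝔽 ^ n - Fintype.card 𝔽 ^ j := by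
    rw [Set.compl_eq_univ_sdiff, hP.ncard_diff isFlat_univ (subset_univ P)]
  have hpts : ∀ K ∈ A3 𝔽 P k, {x ∈ Pᶜ | x ∈ K}.ncard =
      Fintype.card 𝔽 ^ k - Fintype.card 𝔽 ^ j := fun K hK => by
    rw [← hP.ncard_diff hK.1 hK.2]
    congr 1
    ext x
    simp [and_comm]
  have hflats : ∀ x ∈ Pᶜ, {K ∈ A3 𝔽 P k | x ∈ K}.ncard = c := fun x hx => by
    obtain ⟨R, hR, h⟩ := hP.exists_join_A3 hx
    rw [h, hc R hR]
  rw [← hout]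
  refine le_antisymm (ncard_mul_le_ncard_mul (fun K x => x ∈ K) (fun K hK => (hpts K hK).ge)
    fun x hx => (hflats x hx).le) ?_
  exact ncard_mul_le_ncard_mul (fun x K => x ∈ K) (fun x hx => (hflats x hx).ge)
    fun K hK => (hpts K hK).le

/-- The number of `k`-flats through a `j`-flat depends only on `j`. -/
theorem exists_ncard_A3_eq (𝔽 : Type) [Field 𝔽] [Fintype 𝔽] (n j k : ℕ) :
    ∃ c, ∀ P : Set (Fin n → 𝔽), IsFlat 𝔽 j P → (A3 𝔽 P k).ncard = c := by
  rcases lt_or_ge k j with hkj | hjk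
  · refine ⟨0, fun P hP => (Set.ncard_eq_zero (Set.toFinite _)).2 (Set.eq_empty_of_forall_notMem
      fun K hK => ?_)⟩
    exact hkj.not_ge (hP.dim_le_of_subset hK.1 hK.2)
  · induction hjk using Nat.decreasingInduction with
    | self =>
      refine ⟨1, fun P hP => Set.ncard_eq_one.2 ⟨P, Set.ext fun K => ?_⟩⟩
      refine ⟨fun hK => (hP.eq_of_subset hK.1 hK.2 le_rfl).symm, ?_⟩
      rintro rfl
      exact ⟨hP, subset_rfl⟩
    | of_succ j hj ih =>
      obtain ⟨c, hc⟩ := ih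
      have hpos : 0 < Fintype.card 𝔽 ^ k - Fintype.card 𝔽 ^ j :=
        Nat.sub_pos_of_lt (Nat.pow_lt_pow_right Fintype.one_lt_card hj)
      exact ⟨_, fun P hP => Nat.eq_div_of_mul_eq_left hpos.ne' (ncard_A3_mul hP hc)⟩

theorem ncard_A3_congr (hP : IsFlat 𝔽 j P) (hR : IsFlat 𝔽 j R) :
    (A3 𝔽 P k).ncard = (A3 𝔽 R k).ncard := by
  obtain ⟨c, hc⟩ := exists_ncard_A3_eq 𝔽 n j k
  rw [hc P hP, hc R hR]

theorem ncard_A3_succ_mul_le (hP : IsFlat 𝔽 j P) (hR : IsFlat 𝔽 (j + 1) R) (hkn : k ≤ n) :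
    (A3 𝔽 R k).ncard * Fintype.card 𝔽 ^ (n - k) ≤ (A3 𝔽 P k).ncard := by
  rcases le_or_gt k j with hkj | hjk
  · have : A3 𝔽 R k = ∅ := Set.eq_empty_of_forall_notMem fun K hK => by
      have := hR.dim_le_of_subset hK.1 hK.2
      omega
    simp [this]
  have h := ncard_A3_mul (k := k) hP fun R' hR' => ncard_A3_congr hR' hR
  have hpos : 0 < Fintype.card 𝔽 ^ k - Fintype.card 𝔽 ^ j :=
    Nat.sub_pos_of_lt (Nat.pow_lt_pow_right Fintype.one_lt_card hjk)
  refine Nat.le_of_mul_le_mul_right ?_ hpos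
  rw [h, mul_comm _ (A3 𝔽 R k).ncard, mul_assoc]
  gcongr
  rw [Nat.mul_sub, ← pow_add, ← pow_add, Nat.sub_add_cancel hkn]
  exact Nat.sub_le_sub_left (Nat.pow_le_pow_right Fintype.card_pos (by omega)) _

theorem ncard_A3_pos (hP : IsFlat 𝔽 j P) (hjk : j ≤ k) (hkn : k ≤ n) :
    0 < (A3 𝔽 P k).ncard := by
  induction hjk using Nat.decreasingInduction generalizing P with
  | self => exact (Set.ncard_pos (Set.toFinite _)).2 ⟨P, hP, subset_rfl⟩
  | of_succ j hj ih =>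
    obtain ⟨R, hR, hPR⟩ := hP.exists_superset (hj.trans_le hkn)
    exact (ih hR).trans_le (Set.ncard_le_ncard (fun K hK => ⟨hK.1, hPR.trans hK.2⟩)
      (Set.toFinite _))

/-- The number of hyperplanes of a flat is at most the number of affine functionals on it. -/
theorem ncard_hyperplanes_le (hS : IsFlat 𝔽 (k + 1) S) :
    {L | IsFlat 𝔽 k L ∧ L ⊆ S}.ncard ≤ Fintype.card 𝔽 ^ (k + 2) := by
  obtain ⟨p, hp⟩ := hS.nonempty
  obtain ⟨U, hU, rfl⟩ := hS.exists_eq_coset hp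
  let f : Dual 𝔽 U × 𝔽 → Set (Fin n → 𝔽) := fun φ => {v | ∃ h : v - p ∈ U, φ.1 ⟨v - p, h⟩ = φ.2}
  have hfin : Finite (Dual 𝔽 U) := Module.finite_of_finite 𝔽
  have hcard : Nat.card (Dual 𝔽 U × 𝔽) = Fintype.card 𝔽 ^ (k + 2) := by
    rw [Nat.card_prod, natCard_eq_pow_finrank (K := 𝔽), Subspace.dual_finrank_eq, hU,
      Nat.card_eq_fintype_card]
    rfl
  rw [← hcard, ← Set.ncard_univ]
  refine (Set.ncard_le_ncard (t := f '' Set.univ) ?_ (Set.toFinite _)).trans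
    (Set.ncard_image_le Set.finite_univ)
  rintro L ⟨hL, hLS⟩
  obtain ⟨l, hl⟩ := hL.nonempty
  obtain ⟨W, hW, rfl⟩ := hL.exists_eq_coset hl
  have hlU : l - p ∈ U := hLS hl
  have hWU : W ≤ U := fun w hw => by
    have : w + l - p ∈ U := hLS (by simpa using hw)
    rwa [add_sub_assoc, U.add_mem_iff_left hlU] at this
  have hfr : finrank 𝔽 (W.comap U.subtype) = k := by
    rw [(Submodule.comapSubtypeEquivOfLe hWU).finrank_eq, hW]
  obtain ⟨φ, hφ, hle⟩ := (W.comap U.subtype).exists_le_ker_of_lt_top (by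
    refine lt_top_iff_ne_top.2 fun h => ?_
    rw [h, finrank_top] at hfr
    omega)
  have hker : W.comap U.subtype = LinearMap.ker φ := by
    refine Submodule.eq_of_le_of_finrank_eq hle ?_
    have := Dual.finrank_ker_add_one_of_ne_zero hφ
    omega
  refine ⟨(φ, φ ⟨l - p, hlU⟩), trivial, Set.ext fun v => ?_⟩
  have hmem : ∀ h : v - p ∈ U, φ ⟨v - p, h⟩ = φ ⟨l - p, hlU⟩ ↔ v - l ∈ W := fun h => by
    rw [← sub_eq_zero, ← map_sub, ← LinearMap.mem_ker, ← hker, Submodule.mem_comap]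
    simp
  refine ⟨fun ⟨h, hv⟩ => (hmem h).1 hv, fun hv => ?_⟩
  have h : v - p ∈ U := hLS hv
  exact ⟨h, (hmem h).2 hv⟩

end Counting

section Bounds

variable {𝔽 : Type} [Field 𝔽] [Fintype 𝔽] {n : ℕ} {k k₁ k₂ m t : ℕ}
  {A B M M' S T R Z : Set (Fin n → 𝔽)} {F : Set (Set (Fin n → 𝔽))}

theorem ncard_mul_le_of_le_ncard_inter (hT : IsFlat 𝔽 t T) (hS : IsFlat 𝔽 (t + 1) S)
    (hF : F ⊆ A3 𝔽 T k) (hZ : Disjoint Z T) (hm : ∀ A ∈ F, m ≤ (Z ∩ A).ncard) :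
    F.ncard * m ≤ Z.ncard * (A3 𝔽 S k).ncard := by
  refine ncard_mul_le_ncard_mul (fun A x => x ∈ A) hm fun x hx => ?_
  obtain ⟨R, hR, h⟩ := hT.exists_join_A3 (hZ.notMem_of_mem_left hx)
  rw [ncard_A3_congr hS hR, ← h k]
  exact Set.ncard_le_ncard (fun K hK => ⟨hF hK.1, hK.2⟩) (Set.toFinite _)

theorem subset_of_isTCover_A3 (hT : IsFlat 𝔽 t T) (hS : IsFlat 𝔽 (t + 1) S)
    (hk : t + 1 ≤ k) (hn : k + t + 1 < n) (hcov : IsTCover 𝔽 t S (A3 𝔽 T k)) : T ⊆ S := by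
  by_contra hTS
  have hmeet : ∀ B ∈ A3 𝔽 T k, 1 ≤ (S \ T ∩ B).ncard := fun B hB => by
    refine (Set.ncard_pos (Set.toFinite _)).2 ?_
    by_contra! hemp
    obtain ⟨j, hj, hSB⟩ := hcov B hB
    have hsub : S ∩ B ⊆ T := fun x hx => by
      by_contra hxT
      exact (hemp.subset ⟨⟨hx.1, hxT⟩, hx.2⟩ : x ∈ (∅ : Set (Fin n → 𝔽)))
    exact hTS ((hSB.eq_of_subset hT hsub hj).superset.trans inter_subset_left)
  have h₁ := ncard_mul_le_of_le_ncard_inter hT hS subset_rfl disjoint_sdiff_left hmeet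
  have h₂ := ncard_A3_succ_mul_le (k := k) hT hS (by omega)
  have hpos := ncard_A3_pos hS hk (by omega)
  have h₃ : (S \ T).ncard ≤ Fintype.card 𝔽 ^ (t + 1) := by
    rw [← hS.ncard_eq]
    exact Set.ncard_le_ncard Set.sdiff_subset (Set.toFinite _)
  have h₄ : Fintype.card 𝔽 ^ (t + 1) < Fintype.card 𝔽 ^ (n - k) :=
    Nat.pow_lt_pow_right Fintype.one_lt_card (by omega)
  nlinarith

theorem le_ncard_A1_mul (hT : IsFlat 𝔽 t T) (hS : IsFlat 𝔽 (t + 1) S) (hR : IsFlat 𝔽 (t + 2) R)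
    (hM : IsFlat 𝔽 m M) (hTM : T ⊆ M) :
    (Fintype.card 𝔽 ^ m - Fintype.card 𝔽 ^ t) *
        ((A3 𝔽 S k).ncard - Fintype.card 𝔽 ^ m * (A3 𝔽 R k).ncard) ≤
      (A1 𝔽 M T k t).ncard * (Fintype.card 𝔽 ^ (t + 1) - Fintype.card 𝔽 ^ t) := by
  rw [← hT.ncard_diff hM hTM]
  let G := {F ∈ A1 𝔽 M T k t | IsFlat 𝔽 (t + 1) (F ∩ M)}
  refine le_trans (ncard_mul_le_ncard_mul (t := G)
      (d := Fintype.card 𝔽 ^ (t + 1) - Fintype.card 𝔽 ^ t)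
      (fun x F => x ∈ F) (fun x hx => ?_) fun F hF => ?_)
    (Nat.mul_le_mul_right _ (Set.ncard_le_ncard (Set.sep_subset _ _) (Set.toFinite _)))
  · obtain ⟨U, hU, hTU, hxU, hmin⟩ := hT.exists_join_point hx.2
    have hUM : U ⊆ M := hmin m M hM hTM hx.1
    let bad := {F ∈ A3 𝔽 U k | (M \ U ∩ F).Nonempty}
    have hbad : bad.ncard ≤ Fintype.card 𝔽 ^ m * (A3 𝔽 R k).ncard := by
      have := ncard_mul_le_of_le_ncard_inter (m := 1) (F := bad) hU hR (Set.sep_subset _ _)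
        (Z := M \ U) disjoint_sdiff_left fun F hF => (Set.ncard_pos (Set.toFinite _)).2 hF.2
      rw [mul_one] at this
      refine this.trans (Nat.mul_le_mul_right _ ?_)
      rw [← hM.ncard_eq]
      exact Set.ncard_le_ncard Set.sdiff_subset (Set.toFinite _)
    rw [ncard_A3_congr hS hU]
    refine ((Nat.sub_le_sub_left hbad _).trans (Set.le_ncard_sdiff _ _)).trans
      (Set.ncard_le_ncard (fun F hF => ?_) (Set.toFinite _))
    have hFM : F ∩ M = U := by
      refine Subset.antisymm (fun y hy => ?_) (subset_inter hF.1.2 hUM)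
      by_contra hyU
      exact hF.2 ⟨hF.1, y, ⟨hy.2, hyU⟩, hy.1⟩
    refine ⟨⟨⟨hF.1.1, hTU.trans hF.1.2, ?_⟩, ?_⟩, hF.1.2 hxU⟩
    · exact ⟨t + 1, le_rfl, by rwa [hFM]⟩
    · rwa [hFM]
  · rw [← hT.ncard_diff hF.2 (subset_inter hF.1.2.1 hTM)]
    refine Set.ncard_le_ncard (fun x hx => ⟨⟨hx.2, hx.1.1⟩, hx.1.2⟩) (Set.toFinite _)

theorem ncard_mul_le_of_disjoint (hT : IsFlat 𝔽 t T) (hS : IsFlat 𝔽 (t + 1) S)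
    (hF : F ⊆ A3 𝔽 T k₁) (hB : IsFlat 𝔽 k₂ B) (hBT : Disjoint B T)
    (h : ∀ A ∈ F, DimGe 𝔽 t (A ∩ B)) :
    F.ncard * Fintype.card 𝔽 ^ t ≤ Fintype.card 𝔽 ^ k₂ * (A3 𝔽 S k₁).ncard := by
  rw [← hB.ncard_eq]
  refine ncard_mul_le_of_le_ncard_inter hT hS hF hBT fun A hA => ?_
  rw [inter_comm]
  exact (h A hA).ncard_le

theorem exists_ncard_le_of_ne (hT : IsFlat 𝔽 t T) (hS : IsFlat 𝔽 (t + 1) S)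
    (hR : IsFlat 𝔽 (t + 2) R) (hF : F ⊆ A3 𝔽 T k) (hM : IsFlat 𝔽 (m + 1) M)
    (hM' : IsFlat 𝔽 (m + 1) M') (hTM : T ⊆ M) (hTM' : T ⊆ M') (hne : M ≠ M')
    (h : ∀ A ∈ F, DimGe 𝔽 (t + 1) (A ∩ M)) (h' : ∀ A ∈ F, DimGe 𝔽 (t + 1) (A ∩ M')) :
    ∃ a, F.ncard ≤ a + Fintype.card 𝔽 ^ (m + 1) * Fintype.card 𝔽 ^ (m + 1) * (A3 𝔽 R k).ncard ∧
      a * (Fintype.card 𝔽 ^ (t + 1) - Fintype.card 𝔽 ^ t) ≤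
        (Fintype.card 𝔽 ^ m - Fintype.card 𝔽 ^ t) * (A3 𝔽 S k).ncard := by
  have hTMM' : T ⊆ M ∩ M' := subset_inter hTM hTM'
  obtain ⟨i, hI⟩ := hM.inter hM' (hT.nonempty.mono hTMM')
  have him : i ≤ m := Nat.lt_succ_iff.1 (hI.dim_lt_of_subset_of_not_subset hM inter_subset_left
    fun hs => hne (hM.eq_of_subset hM' (hs.trans inter_subset_right) le_rfl))
  let G := {A ∈ F | ((M ∩ M') \ T ∩ A).Nonempty}
  refine ⟨G.ncard, ?_, ?_⟩
  · have hrest : (F \ G).ncard * 1 ≤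
        ((M \ M') ×ˢ (M' \ M)).ncard * (A3 𝔽 R k).ncard := by
      refine ncard_mul_le_ncard_mul (fun A p => p.1 ∈ A ∧ p.2 ∈ A) (fun A hA => ?_) ?_
      · have hmeet : ∀ N N' : Set (Fin n → 𝔽), M ∩ M' = N ∩ N' → DimGe 𝔽 (t + 1) (A ∩ N) →
            ∃ x ∈ N \ N', x ∈ A := by
          rintro N N' hNN' ⟨j, hj, hAN⟩
          by_contra! hall
          have hsub : A ∩ N ⊆ T := fun x hx => by
            by_contra hxT
            refine hA.2 ⟨hA.1, x, ⟨?_, hxT⟩, hx.1⟩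
            rw [hNN']
            refine ⟨hx.2, ?_⟩
            by_contra hxN'
            exact hall x ⟨hx.2, hxN'⟩ hx.1
          have := hAN.dim_le_of_subset hT hsub
          omega
        obtain ⟨x, hx, hxA⟩ := hmeet M M' rfl (h A hA.1)
        obtain ⟨y, hy, hyA⟩ := hmeet M' M (inter_comm _ _) (h' A hA.1)
        exact (Set.ncard_pos (Set.toFinite _)).2 ⟨(x, y), ⟨hx, hy⟩, hxA, hyA⟩
      · rintro ⟨x, y⟩ ⟨hx, hy⟩
        obtain ⟨U, hU, hTU, hxU, hmin⟩ := hT.exists_join_point fun hxT => hx.2 (hTM' hxT)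
        have hyU : y ∉ U := fun hyU => hy.2 (hmin _ M hM hTM hx.1 hyU)
        obtain ⟨W, hW, hUW, hyW, hminW⟩ := hU.exists_join_point hyU
        rw [ncard_A3_congr hR hW]
        exact Set.ncard_le_ncard (fun K ⟨⟨hKF, _⟩, hxK, hyK⟩ => ⟨(hF hKF).1,
          hminW k K (hF hKF).1 (hmin k K (hF hKF).1 (hF hKF).2 hxK) hyK⟩) (Set.toFinite _)
    have hle : ∀ N N' : Set (Fin n → 𝔽), IsFlat 𝔽 (m + 1) N →
        (N \ N').ncard ≤ Fintype.card 𝔽 ^ (m + 1) := fun N N' hN => by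
      rw [← hN.ncard_eq]
      exact Set.ncard_le_ncard Set.sdiff_subset (Set.toFinite _)
    rw [mul_one, Set.ncard_prod] at hrest
    rw [← Set.ncard_sdiff_add_ncard_of_subset (Set.sep_subset F _) (Set.toFinite _), add_comm]
    exact Nat.add_le_add_left (hrest.trans (Nat.mul_le_mul_right _
      (Nat.mul_le_mul (hle M M' hM) (hle M' M hM')))) _
  · have hG : ∀ A ∈ G, Fintype.card 𝔽 ^ (t + 1) - Fintype.card 𝔽 ^ t ≤
        ((M ∩ M') \ T ∩ A).ncard := fun A hA => by
      obtain ⟨x, ⟨hxI, hxT⟩, hxA⟩ := hA.2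
      have hAT := hF hA.1
      obtain ⟨U, hU, hTU, hxU, hmin⟩ := hT.exists_join_point hxT
      rw [← hT.ncard_diff hU hTU]
      exact Set.ncard_le_ncard (fun y hy => ⟨⟨hmin i _ hI hTMM' hxI hy.1, hy.2⟩,
        hmin k A hAT.1 hAT.2 hxA hy.1⟩) (Set.toFinite _)
    refine (ncard_mul_le_of_le_ncard_inter hT hS ((Set.sep_subset _ _).trans hF)
      disjoint_sdiff_left hG).trans (Nat.mul_le_mul_right _ ?_)
    rw [hT.ncard_diff hI hTMM']
    exact Nat.sub_le_sub_right (Nat.pow_le_pow_right Fintype.card_pos him) _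

theorem ncard_le_of_not_subset (hT : IsFlat 𝔽 t T) (hS : IsFlat 𝔽 (t + 1) S) (hTS : T ⊆ S)
    (hA : IsFlat 𝔽 k₁ A) (hTA : T ⊆ A) (hSA : ¬ S ⊆ A)
    (hF : ∀ B ∈ F, IsFlat 𝔽 k₂ B ∧ ¬ T ⊆ B ∧ DimGe 𝔽 t (S ∩ B) ∧ DimGe 𝔽 t (A ∩ B)) :
    F.ncard ≤ Fintype.card 𝔽 ^ (t + 2) * Fintype.card 𝔽 ^ k₁ * (A3 𝔽 S k₂).ncard := by
  let D := {p : Set (Fin n → 𝔽) × (Fin n → 𝔽) | (IsFlat 𝔽 t p.1 ∧ p.1 ⊆ S) ∧ p.2 ∈ A \ p.1}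
  have hcount : F.ncard * 1 ≤ D.ncard * (A3 𝔽 S k₂).ncard := by
    refine ncard_mul_le_ncard_mul (fun B p => p.1 ⊆ B ∧ p.2 ∈ B) (fun B hB => ?_) ?_
    · obtain ⟨hBf, hTB, ⟨j, hj, hSB⟩, ⟨l, hl, hAB⟩⟩ := hF B hB
      obtain rfl : j = t := by
        have := hSB.dim_lt_of_subset_of_not_subset hS inter_subset_left
          fun hs => hTB (hTS.trans (hs.trans inter_subset_right))
        omega
      obtain ⟨x, hxAB, hxS⟩ : ∃ x ∈ A ∩ B, x ∉ S ∩ B := by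
        by_contra! hall
        obtain ⟨i, hAS⟩ := hA.inter hS (hT.nonempty.mono (subset_inter hTA hTS))
        have hi := hAS.dim_lt_of_subset_of_not_subset hS inter_subset_right
          fun hs => hSA (hs.trans inter_subset_left)
        have hTAS := hT.eq_of_subset hAS (subset_inter hTA hTS) (by omega)
        have hsub : A ∩ B ⊆ T := hTAS ▸ fun x hx => ⟨hx.1, (hall x hx).1⟩
        exact hTB ((hAB.eq_of_subset hT hsub hl).superset.trans inter_subset_right)
      exact (Set.ncard_pos (Set.toFinite _)).2 ⟨(S ∩ B, x), ⟨⟨hSB, inter_subset_left⟩,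
        hxAB.1, hxS⟩, inter_subset_right, hxAB.2⟩
    · rintro ⟨L, x⟩ ⟨⟨hL, -⟩, -, hxL⟩
      obtain ⟨U, hU, -, -, hmin⟩ := hL.exists_join_point hxL
      rw [ncard_A3_congr hS hU]
      exact Set.ncard_le_ncard (fun B ⟨hB, hLB, hxB⟩ => ⟨(hF B hB).1,
        hmin k₂ B (hF B hB).1 hLB hxB⟩) (Set.toFinite _)
  rw [mul_one] at hcount
  refine hcount.trans (Nat.mul_le_mul_right _ ?_)
  calc D.ncard ≤ ({L | IsFlat 𝔽 t L ∧ L ⊆ S} ×ˢ A).ncard :=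
        Set.ncard_le_ncard (fun p hp => ⟨hp.1, hp.2.1⟩) (Set.toFinite _)
    _ ≤ _ := by
      rw [Set.ncard_prod, hA.ncard_eq]
      exact Nat.mul_le_mul_right _ (ncard_hyperplanes_le hS)

end Bounds

section Arithmetic

variable {q n k₁ k₂ b t X X₂ Y Y₁ a a₁ a₂ f f₁ f₂ : ℕ}

theorem mul_pow_le_of_le_add (hq : 0 < q) (hn : k₁ + (t + b) + t + 7 ≤ n)
    (hX : X₂ * q ^ (n - k₁) ≤ X) (ha : a ≤ q ^ b * X)
    (hf : f ≤ a + q ^ (t + b + 1) * q ^ (t + b + 1) * X₂) :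
    f * q ^ 5 ≤ (q ^ 5 + 1) * q ^ b * X := by
  have h : q ^ (t + b + 1) * q ^ (t + b + 1) * X₂ * q ^ 5 ≤ q ^ b * X :=
    calc _ = q ^ b * (X₂ * q ^ (2 * t + b + 7)) := by ring
      _ ≤ q ^ b * (X₂ * q ^ (n - k₁)) := by
        gcongr
        omega
      _ ≤ _ := by gcongr
  calc f * q ^ 5 ≤ (a + q ^ (t + b + 1) * q ^ (t + b + 1) * X₂) * q ^ 5 := by gcongr
    _ = a * q ^ 5 + q ^ (t + b + 1) * q ^ (t + b + 1) * X₂ * q ^ 5 := by ring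
    _ ≤ q ^ b * X * q ^ 5 + q ^ b * X := by gcongr
    _ = _ := by ring

theorem le_pow_mul_of_mul_le (hq : 1 < q)
    (h : a * (q ^ (t + 1) - q ^ t) ≤ (q ^ (t + b) - q ^ t) * X) : a ≤ q ^ b * X := by
  have hqt : 0 < q ^ t := pow_pos (by omega) t
  have e₁ : q ^ (t + 1) - q ^ t = q ^ t * (q - 1) := by rw [Nat.mul_sub, pow_succ, mul_one]
  have e₂ : q ^ t ≤ q ^ t * (q - 1) := Nat.le_mul_of_pos_right _ (by omega)
  rw [e₁] at h
  refine Nat.le_of_mul_le_mul_right (c := q ^ t) ?_ hqt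
  calc a * q ^ t ≤ a * (q ^ t * (q - 1)) := by gcongr
    _ ≤ (q ^ (t + b) - q ^ t) * X := h
    _ ≤ q ^ (t + b) * X := by gcongr; exact Nat.sub_le _ _
    _ = _ := by ring

theorem mul_pow_le_of_le_add_mul (hq : 0 < q) (hn : k₁ + k₂ + t + 7 ≤ n)
    (hY : Y₁ * q ^ (n - k₂) ≤ Y) (hf : f ≤ Y + q ^ (t + 2) * q ^ k₁ * Y₁) :
    f * q ^ 5 ≤ (q ^ 5 + 1) * Y := by
  have h : q ^ (t + 2) * q ^ k₁ * Y₁ * q ^ 5 ≤ Y :=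
    calc _ = Y₁ * q ^ (k₁ + t + 7) := by ring
      _ ≤ Y₁ * q ^ (n - k₂) := by
        gcongr
        omega
      _ ≤ _ := hY
  calc f * q ^ 5 ≤ (Y + q ^ (t + 2) * q ^ k₁ * Y₁) * q ^ 5 := by gcongr
    _ = Y * q ^ 5 + q ^ (t + 2) * q ^ k₁ * Y₁ * q ^ 5 := by ring
    _ ≤ Y * q ^ 5 + Y := by gcongr
    _ = _ := by ring

theorem le_mul_of_mul_sub_le (ht : 0 < t) (hq : 0 < q) (hn : k₁ + (t + b) + t + 7 ≤ n)
    (hX : X₂ * q ^ (n - k₁) ≤ X)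
    (h : (q ^ (t + b + 1) - q ^ t) * (X - q ^ (t + b + 1) * X₂) ≤ a * (q ^ (t + 1) - q ^ t)) :
    (q ^ (b + 1) - 1) * ((q ^ 7 - 1) * X) ≤ a * (q - 1) * q ^ 7 := by
  have hqt : 0 < q ^ t := pow_pos hq t
  have e₁ : q ^ (t + 1) - q ^ t = q ^ t * (q - 1) := by rw [Nat.mul_sub, pow_succ, mul_one]
  have e₂ : q ^ (t + b + 1) - q ^ t = q ^ t * (q ^ (b + 1) - 1) := by
    rw [Nat.mul_sub, ← pow_add, mul_one, add_assoc]
  rw [e₁, e₂, mul_assoc, mul_left_comm a] at h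
  have h' := Nat.le_of_mul_le_mul_left h hqt
  have hX' : q ^ (t + b + 1) * X₂ * q ^ 7 ≤ X :=
    calc _ = X₂ * q ^ (t + b + 8) := by ring
      _ ≤ X₂ * q ^ (n - k₁) := by
        gcongr
        omega
      _ ≤ _ := hX
  have h₇ : (q ^ 7 - 1) * X ≤ (X - q ^ (t + b + 1) * X₂) * q ^ 7 := by
    rw [Nat.sub_mul, Nat.sub_mul, one_mul, mul_comm X]
    exact Nat.sub_le_sub_left hX' _
  calc _ ≤ (q ^ (b + 1) - 1) * ((X - q ^ (t + b + 1) * X₂) * q ^ 7) := by gcongr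
    _ = (q ^ (b + 1) - 1) * (X - q ^ (t + b + 1) * X₂) * q ^ 7 := by ring
    _ ≤ _ := by gcongr

theorem mul_lt_mul_of_bounds (hq : 1 < q) (hb : 1 ≤ b) (hX : 0 < X) (hY : 0 < Y)
    (h₁ : f₁ * q ^ 5 ≤ (q ^ 5 + 1) * q ^ b * X) (h₂ : f₂ * q ^ 5 ≤ (q ^ 5 + 1) * Y)
    (h₃ : (q ^ (b + 1) - 1) * ((q ^ 7 - 1) * X) ≤ a₁ * (q - 1) * q ^ 7) (h₄ : Y ≤ a₂) :
    f₁ * f₂ < a₁ * a₂ := by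
  obtain ⟨r, rfl⟩ : ∃ r, q = r + 2 := ⟨q - 2, by omega⟩
  have hu : r + 2 ≤ (r + 2) ^ b := Nat.le_self_pow (by omega) _
  have hgeom : (r + 2) ^ b * (r + 3) * (r + 1) ≤ (r + 2) * ((r + 2) ^ (b + 1) - 1) := by
    rw [Nat.mul_sub, pow_succ, mul_one]
    refine Nat.le_sub_of_add_le ?_
    nlinarith
  have hpoly : ((r + 2) ^ 5 + 1) ^ 2 * (r + 2) ^ 8 <
      (r + 3) * ((r + 2) ^ 7 - 1) * (r + 2) ^ 10 := by
    have h : ((r + 2) ^ 5 + 1) ^ 2 < (r + 3) * ((r + 2) ^ 7 - 1) * (r + 2) ^ 2 := by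
      have : 1 ≤ (r + 2) ^ 7 := Nat.one_le_pow _ _ (by omega)
      zify [this]
      rw [← sub_pos]
      ring_nf
      positivity
    calc _ < (r + 3) * ((r + 2) ^ 7 - 1) * (r + 2) ^ 2 * (r + 2) ^ 8 := by gcongr
      _ = _ := by ring
  refine Nat.lt_of_mul_lt_mul_right (a := (r + 1) * (r + 2) ^ 18) ?_
  calc f₁ * f₂ * ((r + 1) * (r + 2) ^ 18)
      = (f₁ * (r + 2) ^ 5) * (f₂ * (r + 2) ^ 5) * ((r + 1) * (r + 2) ^ 8) := by ring
    _ ≤ (((r + 2) ^ 5 + 1) * (r + 2) ^ b * X) * (((r + 2) ^ 5 + 1) * Y) *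
          ((r + 1) * (r + 2) ^ 8) := by gcongr
    _ = ((r + 2) ^ 5 + 1) ^ 2 * (r + 2) ^ 8 * ((r + 2) ^ b * (r + 1) * (X * Y)) := by ring
    _ < (r + 3) * ((r + 2) ^ 7 - 1) * (r + 2) ^ 10 * ((r + 2) ^ b * (r + 1) * (X * Y)) := by
      gcongr
    _ = ((r + 2) ^ b * (r + 3) * (r + 1)) * (((r + 2) ^ 7 - 1) * (X * Y) * (r + 2) ^ 10) := by ring
    _ ≤ ((r + 2) * ((r + 2) ^ (b + 1) - 1)) * (((r + 2) ^ 7 - 1) * (X * Y) * (r + 2) ^ 10) := by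
      gcongr
    _ = ((r + 2) ^ (b + 1) - 1) * (((r + 2) ^ 7 - 1) * X) * Y * (r + 2) ^ 11 := by ring
    _ ≤ (a₁ * (r + 1) * (r + 2) ^ 7) * a₂ * (r + 2) ^ 11 :=
      Nat.mul_le_mul_right _ (Nat.mul_le_mul h₃ h₄)
    _ = a₁ * a₂ * ((r + 1) * (r + 2) ^ 18) := by ring

end Arithmetic

section Structure

theorem exists_isTCover_of_tauT_eq {𝔽 : Type} [Field 𝔽] {n j t : ℕ} {F : Set (Set (Fin n → 𝔽))}
    (ht : 0 < t) (h : tauT 𝔽 j F = t) :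
    ∃ T, IsFlat 𝔽 t T ∧ IsTCover 𝔽 j T F := by
  have hne : {x | ∃ T : Set (Fin n → 𝔽), IsFlat 𝔽 x T ∧ IsTCover 𝔽 j T F}.Nonempty :=
    Nat.nonempty_of_pos_sInf (by rwa [← h] at ht)
  have := Nat.sInf_mem hne
  rwa [← tauT, h] at this

variable {𝔽 : Type} [Field 𝔽] [Fintype 𝔽] {n : ℕ} {j k k₁ k₂ t : ℕ} {A B M R S T : Set (Fin n → 𝔽)}

theorem isFlat_inter_of_not_subset (ht : 0 < t) (hT : IsFlat 𝔽 t T) (hS : IsFlat 𝔽 (t + 1) S)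
    (hTS : T ⊆ S) (hSB : DimGe 𝔽 t (S ∩ B)) (hTB : ¬ T ⊆ B)
    (hne : (B ∩ T).Nonempty) : IsFlat 𝔽 (t - 1) (B ∩ T) := by
  obtain ⟨j, hj, hSB⟩ := hSB
  have hSBT : S ∩ B ∩ T = B ∩ T := by
    rw [inter_assoc, inter_eq_right.2 (inter_subset_right.trans hTS)]
  obtain ⟨i, hi, hBT⟩ := dimGe_inter_of_subset (s := t - 1) hSB hT hS inter_subset_left hTS
    (by rwa [hSBT]) (by omega)
  rw [hSBT] at hBT
  have := hBT.dim_lt_of_subset_of_not_subset hT inter_subset_right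
    fun h => hTB (h.trans inter_subset_left)
  rwa [show t - 1 = i by omega]

theorem dimGe_inter_of_mem_A1_of_mem_A2 (hM : IsFlat 𝔽 (k₂ + 1) M) (hT : IsFlat 𝔽 t T)
    (hTM : T ⊆ M) (hA : A ∈ A1 𝔽 M T k₁ t) (hB : B ∈ A2 𝔽 M T k₂ t) : DimGe 𝔽 t (A ∩ B) := by
  rcases hB with ⟨hBf, hTB⟩ | ⟨hBf, hBM, hBT⟩
  · exact dimGe_inter_of_subset_subset hT hA.1 hBf hA.2.1 hTB
  · obtain ⟨j, hj, hAM⟩ := hA.2.2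
    have h : A ∩ M ∩ B = A ∩ B := by rw [inter_assoc, inter_eq_right.2 hBM]
    rw [← h]
    refine dimGe_inter_of_subset hAM hBf hM inter_subset_right hBM ?_ (by omega)
    obtain ⟨x, hxB, hxT⟩ := hBT.nonempty
    exact ⟨x, ⟨hA.2.1 hxT, hTM hxT⟩, hxB⟩

/-- A flat through `T` that meets `B ⊉ T` in dimension `t` meets every flat containing `B` and
`T` in dimension `t + 1`. -/
theorem dimGe_succ_inter_of_not_subset (hT : IsFlat 𝔽 t T) (hA : IsFlat 𝔽 k A) (hTA : T ⊆ A)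
    (hTB : ¬ T ⊆ B) (hAB : DimGe 𝔽 t (A ∩ B)) (hM : IsFlat 𝔽 j M) (hTM : T ⊆ M) (hBM : B ⊆ M) :
    DimGe 𝔽 (t + 1) (A ∩ M) := by
  obtain ⟨i, hi, hAB⟩ := hAB
  obtain ⟨x, hx, hxT⟩ : ∃ x ∈ A ∩ B, x ∉ T := by
    by_contra! h
    exact hTB ((hAB.eq_of_subset hT h hi).superset.trans inter_subset_right)
  obtain ⟨l, hAM⟩ := hA.inter hM ⟨x, hx.1, hBM hx.2⟩
  exact hT.exists_join_point_of_mem hxT hAM (subset_inter hTA hTM) ⟨hx.1, hBM hx.2⟩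

theorem ncard_mul_ncard_lt_A1_mul_A2 {F₁ F₂ : Set (Set (Fin n → 𝔽))} (ht : 0 < t)
    (hk₁ : t + 1 ≤ k₁) (hk₂ : t + 1 ≤ k₂) (hn : k₁ + k₂ + t + 7 ≤ n)
    (hT : IsFlat 𝔽 t T) (hS : IsFlat 𝔽 (t + 1) S)
    (hR : IsFlat 𝔽 (t + 2) R) {a : ℕ}
    (h₁ : F₁.ncard ≤
      a + Fintype.card 𝔽 ^ (k₂ + 1) * Fintype.card 𝔽 ^ (k₂ + 1) *
        (A3 𝔽 R k₁).ncard)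
    (ha : a ≤ Fintype.card 𝔽 ^ (k₂ - t) * (A3 𝔽 S k₁).ncard)
    (h₂ : F₂.ncard ≤ (A3 𝔽 T k₂).ncard +
      Fintype.card 𝔽 ^ (t + 2) * Fintype.card 𝔽 ^ k₁ * (A3 𝔽 S k₂).ncard)
    {M' T' : Set (Fin n → 𝔽)} (hM' : IsFlat 𝔽 (k₂ + 1) M') (hT' : IsFlat 𝔽 t T')
    (hTM' : T' ⊆ M') :
    F₁.ncard * F₂.ncard < (A1 𝔽 M' T' k₁ t).ncard * (A2 𝔽 M' T' k₂ t).ncard := by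
  have hq : 1 < Fintype.card 𝔽 := Fintype.one_lt_card
  obtain ⟨b, rfl⟩ : ∃ b, k₂ = t + b := ⟨k₂ - t, by omega⟩
  rw [Nat.add_sub_cancel_left] at ha
  have hX := ncard_A3_succ_mul_le (k := k₁) hS hR (by omega)
  have hY := ncard_A3_succ_mul_le (k := t + b) hT hS (by omega)
  refine mul_lt_mul_of_bounds hq (by omega) (ncard_A3_pos hS hk₁ (by omega))
    (ncard_A3_pos (k := t + b) hT (by omega) (by omega))
    (mul_pow_le_of_le_add (by omega) hn hX ha h₁)
    (mul_pow_le_of_le_add_mul (by omega) hn hY h₂)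
    (le_mul_of_mul_sub_le ht (by omega) hn hX (le_ncard_A1_mul hT' hS hR hM' hTM')) ?_
  rw [ncard_A3_congr hT hT']
  exact Set.ncard_le_ncard subset_union_left (Set.toFinite _)

end Structure

theorem stmt_19 (q : ℕ) (hq : IsPrimePow q)
    (𝔽 : Type) [Field 𝔽] [Fintype 𝔽] (hcard : Fintype.card 𝔽 = q)
    (n k1 k2 t : ℕ) (ht : 0 < t) (hk1 : t + 1 ≤ k1) (hk2 : t + 1 ≤ k2)
    (hn : k1 + k2 + t + 7 ≤ n)
    (F1 F2 : Set (Set (Fin n → 𝔽)))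
    (hmax1 : F1 = {A | IsFlat 𝔽 k1 A ∧ ∀ B ∈ F2, DimGe 𝔽 t (A ∩ B)})
    (hmax2 : F2 = {B | IsFlat 𝔽 k2 B ∧ ∀ A ∈ F1, DimGe 𝔽 t (A ∩ B)})
    (hnontriv : ¬ TrivialPair 𝔽 t F1 F2)
    (htau1 : tauT 𝔽 t F1 = t) (htau2 : tauT 𝔽 t F2 = t + 1) :
    (∃ M T : Set (Fin n → 𝔽), IsFlat 𝔽 (k2 + 1) M ∧ IsFlat 𝔽 t T ∧ T ⊆ M ∧
        F1 = A1 𝔽 M T k1 t ∧ F2 = A2 𝔽 M T k2 t) ∨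
    (∃ S : Set (Fin n → 𝔽), IsFlat 𝔽 (t + 1) S ∧
        F1 = A3 𝔽 S k1 ∧ F2 = A4 𝔽 S k2 t) ∨
    (∀ M T : Set (Fin n → 𝔽), IsFlat 𝔽 (k2 + 1) M → IsFlat 𝔽 t T → T ⊆ M →
        F1.ncard * F2.ncard < (A1 𝔽 M T k1 t).ncard * (A2 𝔽 M T k2 t).ncard) := by
  subst hcard
  obtain ⟨T, hT, hcovT⟩ := exists_isTCover_of_tauT_eq ht htau1
  obtain ⟨S, hS, hcovS⟩ := exists_isTCover_of_tauT_eq t.succ_pos htau2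
  have hF1 : ∀ A ∈ F1, IsFlat 𝔽 k1 A ∧ ∀ B ∈ F2, DimGe 𝔽 t (A ∩ B) := fun A hA => by
    rwa [hmax1] at hA
  have hF2 : ∀ B ∈ F2, IsFlat 𝔽 k2 B ∧ ∀ A ∈ F1, DimGe 𝔽 t (A ∩ B) := fun B hB => by
    rwa [hmax2] at hB
  have memF1 : ∀ A, IsFlat 𝔽 k1 A → (∀ B ∈ F2, DimGe 𝔽 t (A ∩ B)) → A ∈ F1 := fun A h h' => by
    rw [hmax1]
    exact ⟨h, h'⟩
  have memF2 : ∀ B, IsFlat 𝔽 k2 B → (∀ A ∈ F1, DimGe 𝔽 t (A ∩ B)) → B ∈ F2 := fun B h h' => by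
    rw [hmax2]
    exact ⟨h, h'⟩
  have hTF1 : ∀ A ∈ F1, T ⊆ A := fun A hA => hT.subset_of_dimGe_inter (hcovT A hA)
  have hA3F2 : A3 𝔽 T k2 ⊆ F2 := fun B hB => memF2 B hB.1 fun A hA =>
    dimGe_inter_of_subset_subset hT (hF1 A hA).1 hB.1 (hTF1 A hA) hB.2
  have hTS : T ⊆ S := subset_of_isTCover_A3 hT hS hk2 (by omega) fun B hB => hcovS B (hA3F2 hB)
  have hA3F1 : A3 𝔽 S k1 ⊆ F1 := fun A hA => memF1 A hA.1 fun B hB => by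
    obtain ⟨j, hj, hSB⟩ := hcovS B hB
    obtain ⟨i, hi, h⟩ := dimGe_inter_of_subset_subset hSB hA.1 (hF2 B hB).1
      (inter_subset_left.trans hA.2) inter_subset_right
    exact ⟨i, hj.trans hi, h⟩
  by_cases hSF1 : ∀ A ∈ F1, S ⊆ A
  · refine Or.inr (Or.inl ⟨S, hS, ?_, ?_⟩)
    · exact Subset.antisymm (fun A hA => ⟨(hF1 A hA).1, hSF1 A hA⟩) hA3F1
    · refine Subset.antisymm (fun B hB => ⟨(hF2 B hB).1, inter_comm S B ▸ hcovS B hB⟩)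
        fun B hB => memF2 B hB.1 fun A hA => ?_
      obtain ⟨j, hj, hBS⟩ := hB.2
      obtain ⟨i, hi, h⟩ := dimGe_inter_of_subset_subset hBS (hF1 A hA).1 hB.1
        (inter_subset_right.trans (hSF1 A hA)) inter_subset_left
      exact ⟨i, hj.trans hi, h⟩
  push Not at hSF1
  obtain ⟨A₀, hA₀, hSA₀⟩ := hSF1
  have hF2le : F2.ncard ≤ (A3 𝔽 T k2).ncard +
      Fintype.card 𝔽 ^ (t + 2) * Fintype.card 𝔽 ^ k1 * (A3 𝔽 S k2).ncard := by
    rw [← Set.ncard_sdiff_add_ncard_of_subset hA3F2 (Set.toFinite _), add_comm]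
    refine Nat.add_le_add_left (ncard_le_of_not_subset hT hS hTS (hF1 A₀ hA₀).1 (hTF1 A₀ hA₀) hSA₀
      fun B hB => ⟨(hF2 B hB.1).1, fun hTB => hB.2 ⟨(hF2 B hB.1).1, hTB⟩, hcovS B hB.1,
        (hF2 B hB.1).2 A₀ hA₀⟩) _
  have hF1A3 : F1 ⊆ A3 𝔽 T k1 := fun A hA => ⟨(hF1 A hA).1, hTF1 A hA⟩
  obtain ⟨R, hR, -⟩ := hS.exists_superset (by omega)
  by_cases hdisj : ∃ B ∈ F2, Disjoint B T
  · obtain ⟨B, hB, hBT⟩ := hdisj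
    refine Or.inr (Or.inr fun M' T' hM' hT' hTM' => ncard_mul_ncard_lt_A1_mul_A2 ht hk1 hk2 hn
      hT hS hR (Nat.le_add_right _ _) ?_ hF2le hM' hT' hTM')
    refine Nat.le_of_mul_le_mul_right (c := Fintype.card 𝔽 ^ t) ?_
      (pow_pos Fintype.card_pos t)
    rw [mul_right_comm, ← pow_add, Nat.sub_add_cancel (by omega)]
    exact ncard_mul_le_of_disjoint hT hS hF1A3 (hF2 B hB).1 hBT fun A hA => (hF1 A hA).2 B hB
  push Not at hdisj
  have hinter : ∀ B ∈ F2, ¬ T ⊆ B → IsFlat 𝔽 (t - 1) (B ∩ T) := fun B hB hTB =>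
    isFlat_inter_of_not_subset ht hT hS hTS (hcovS B hB) hTB
      (Set.not_disjoint_iff_nonempty_inter.1 (hdisj B hB))
  have hjoin : ∀ B ∈ F2, ¬ T ⊆ B → ∃ M, IsFlat 𝔽 (k2 + 1) M ∧ B ⊆ M ∧ T ⊆ M :=
    fun B hB hTB => by
      obtain ⟨M, hM, hBM, hTM, -⟩ := (hF2 B hB).1.exists_join hT (hinter B hB hTB)
      exact ⟨M, by rwa [show k2 + 1 = k2 + t - (t - 1) by omega], hBM, hTM⟩
  have hF1M : ∀ B ∈ F2, ¬ T ⊆ B → ∀ M, IsFlat 𝔽 (k2 + 1) M → B ⊆ M → T ⊆ M →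
      ∀ A ∈ F1, DimGe 𝔽 (t + 1) (A ∩ M) := fun B hB hTB M hM hBM hTM A hA =>
    dimGe_succ_inter_of_not_subset hT (hF1 A hA).1 (hTF1 A hA) hTB ((hF1 A hA).2 B hB) hM hTM hBM
  obtain ⟨B₀, hB₀, hTB₀⟩ : ∃ B ∈ F2, ¬ T ⊆ B := by
    by_contra! h
    exact hnontriv ⟨T, hT, hTF1, h⟩
  obtain ⟨M, hM, hB₀M, hTM⟩ := hjoin B₀ hB₀ hTB₀
  by_cases hall : ∀ B ∈ F2, ¬ T ⊆ B → B ⊆ M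
  · have hF2A2 : F2 ⊆ A2 𝔽 M T k2 t := fun B hB => by
      by_cases hTB : T ⊆ B
      · exact Or.inl ⟨(hF2 B hB).1, hTB⟩
      · exact Or.inr ⟨(hF2 B hB).1, hall B hB hTB, hinter B hB hTB⟩
    have hF1A1 : F1 ⊆ A1 𝔽 M T k1 t := fun A hA =>
      ⟨(hF1 A hA).1, hTF1 A hA, hF1M B₀ hB₀ hTB₀ M hM hB₀M hTM A hA⟩
    refine Or.inl ⟨M, T, hM, hT, hTM, Subset.antisymm hF1A1 fun A hA => ?_,
      Subset.antisymm hF2A2 fun B hB => ?_⟩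
    · exact memF1 A hA.1 fun B hB => dimGe_inter_of_mem_A1_of_mem_A2 hM hT hTM hA (hF2A2 hB)
    · exact memF2 B (hB.elim (fun h => h.1) fun h => h.1) fun A hA =>
        dimGe_inter_of_mem_A1_of_mem_A2 hM hT hTM (hF1A1 hA) hB
  push Not at hall
  obtain ⟨B₁, hB₁, hTB₁, hB₁M⟩ := hall
  obtain ⟨M₁, hM₁, hB₁M₁, hTM₁⟩ := hjoin B₁ hB₁ hTB₁
  refine Or.inr (Or.inr fun M' T' hM' hT' hTM' => ?_)
  obtain ⟨a, hF1le, ha⟩ := exists_ncard_le_of_ne hT hS hR hF1A3 hM hM₁ hTM hTM₁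
    (fun h => hB₁M (h ▸ hB₁M₁)) (hF1M B₀ hB₀ hTB₀ M hM hB₀M hTM)
    (hF1M B₁ hB₁ hTB₁ M₁ hM₁ hB₁M₁ hTM₁)
  refine ncard_mul_ncard_lt_A1_mul_A2 ht hk1 hk2 hn hT hS hR hF1le
    (le_pow_mul_of_mul_le (t := t) Fintype.one_lt_card ?_) hF2le hM' hT' hTM'
  rwa [Nat.add_sub_cancel' (by omega : t ≤ k2)]
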